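/- If the exponential family is minimal, then the forward map θ ↦ ∇A(θ) (sending a canonical parameter to its mean parameter vector (E_θ[φ_α(X)])_{α∈I}) is injective on ℝ^I. -/

import Mathlib

/-- The log-partition function `A(θ) = log Σ_{x∈X} exp⟨θ, φ(x)⟩`. -/
noncomputable def logPartition {X I : Type*} [Fintype X] [Fintype I]
    (φ : X → I → ℝ) (θ : I → ℝ) : ℝ :=
  Real.log (∑ x : X, Real.exp (∑ α : I, θ α * φ x α))

/-- The exponential-family density `p_θ(x) = exp(⟨θ, φ(x)⟩ − A(θ))`. -/
noncomputable def expDensity {X I : Type*} [Fintype X] [Fintype I]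
    (φ : X → I → ℝ) (θ : I → ℝ) (x : X) : ℝ :=
  Real.exp ((∑ α : I, θ α * φ x α) - logPartition φ θ)

/-- The forward map `θ ↦ ∇A(θ) = (E_θ[φ_α(X)])_{α∈I}` sending a canonical
parameter to its mean parameter vector. -/
noncomputable def forwardMap {X I : Type*} [Fintype X] [Fintype I]
    (φ : X → I → ℝ) (θ : I → ℝ) : I → ℝ :=
  fun α => ∑ x : X, φ x α * expDensity φ θ x

/-- Minimality: no nonzero `a ∈ ℝ^I` and constant `c` satisfy
`⟨a, φ(x)⟩ = c` for all `x ∈ X`. -/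
def MinimalFamily {X I : Type*} [Fintype I] (φ : X → I → ℝ) : Prop :=
  ¬ ∃ a : I → ℝ, a ≠ 0 ∧ ∃ c : ℝ, ∀ x : X, ∑ α : I, a α * φ x α = c

theorem sum_expDensity {X I : Type*} [Fintype X] [Nonempty X] [Fintype I]
    (φ : X → I → ℝ) (θ : I → ℝ) : ∑ x : X, expDensity φ θ x = 1 := by
  have hpos : 0 < ∑ x : X, Real.exp (∑ α : I, θ α * φ x α) :=
    Finset.sum_pos (fun x _ => Real.exp_pos _) Finset.univ_nonempty
  simp only [expDensity, logPartition, Real.exp_sub, Real.exp_log hpos]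
  rw [← Finset.sum_div, div_self hpos.ne']

theorem sum_mul_forwardMap {X I : Type*} [Fintype X] [Fintype I]
    (φ : X → I → ℝ) (θ a : I → ℝ) :
    ∑ α : I, a α * forwardMap φ θ α =
      ∑ x : X, (∑ α : I, a α * φ x α) * expDensity φ θ x := by
  simp only [forwardMap, Finset.mul_sum, Finset.sum_mul]
  rw [Finset.sum_comm]
  simp only [mul_assoc]

theorem exp_sub_exp_mul_sub_nonneg (u v : ℝ) :
    0 ≤ (Real.exp u - Real.exp v) * (u - v) := by
  rcases le_total u v with h | h
  · exact mul_nonneg_of_nonpos_of_nonpos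
      (sub_nonpos.2 (Real.exp_le_exp.2 h)) (sub_nonpos.2 h)
  · exact mul_nonneg (sub_nonneg.2 (Real.exp_le_exp.2 h)) (sub_nonneg.2 h)

theorem eq_of_exp_sub_exp_mul_sub_eq_zero {u v : ℝ}
    (h : (Real.exp u - Real.exp v) * (u - v) = 0) : u = v := by
  rcases mul_eq_zero.1 h with h | h
  · exact Real.exp_injective (sub_eq_zero.1 h)
  · exact sub_eq_zero.1 h

/-- If the exponential family is minimal, then the forward map
`θ ↦ ∇A(θ) = (E_θ[φ_α(X)])_{α∈I}` is injective on `ℝ^I`. -/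
theorem minimal_forwardMap_injective
    {X I : Type*} [Fintype X] [Nonempty X] [Fintype I]
    (φ : X → I → ℝ) (hmin : MinimalFamily φ) :
    Function.Injective (forwardMap φ) := by
  intro θ η h
  by_contra hne
  refine hmin ⟨θ - η, sub_ne_zero.2 hne, logPartition φ θ - logPartition φ η, ?_⟩
  have hsplit (x : X) : ∑ α : I, (θ - η) α * φ x α =
      (∑ α : I, θ α * φ x α) - ∑ α : I, η α * φ x α := by
    simp only [Pi.sub_apply, sub_mul, Finset.sum_sub_distrib]
  have hmean := sum_mul_forwardMap φ θ (θ - η)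
  rw [h, sum_mul_forwardMap φ η (θ - η)] at hmean
  have hsum : ∑ x : X, (expDensity φ θ x - expDensity φ η x) *
      (((∑ α : I, θ α * φ x α) - logPartition φ θ) -
        ((∑ α : I, η α * φ x α) - logPartition φ η)) = 0 := by
    calc
      _ = ∑ x : X, ((∑ α : I, (θ - η) α * φ x α) * expDensity φ θ x -
            (∑ α : I, (θ - η) α * φ x α) * expDensity φ η x -
            (logPartition φ θ - logPartition φ η) *
              (expDensity φ θ x - expDensity φ η x)) := by
        refine Finset.sum_congr rfl fun x _ => ?_
        rw [hsplit]
        ring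
      _ = 0 := by
        rw [Finset.sum_sub_distrib, Finset.sum_sub_distrib, ← Finset.mul_sum,
          Finset.sum_sub_distrib, sum_expDensity, sum_expDensity, hmean]
        ring
  intro x
  have hx := (Finset.sum_eq_zero_iff_of_nonneg
    fun x _ => exp_sub_exp_mul_sub_nonneg _ _).1 hsum x (Finset.mem_univ x)
  have heq := eq_of_exp_sub_exp_mul_sub_eq_zero hx
  rw [hsplit]
  linarith
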